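/- Under the stated assumptions on q, ε and w, and if ‖w(0,·)‖_{L²(0,∞)} ≤ 1, then the renormalized solution W_t(x) = exp(ε^{-1}·α₁·∫₀^t q(s)^{2/3} ds)·w(t,x) satisfies ‖W_t‖_{L²(0,∞)} ≤ 1 for every t ∈ [0,1]. -/

import Mathlib

open MeasureTheory Filter Set

/-- The Airy function of the first kind, defined as
`Ai(x) = (1/π) · lim_{R→∞} ∫₀^R cos(t³/3 + x·t) dt`. -/
noncomputable def Ai (x : ℝ) : ℝ :=
  (1 / Real.pi) *
    limUnder Filter.atTop (fun R : ℝ => ∫ t in (0:ℝ)..R, Real.cos (t ^ 3 / 3 + x * t))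

/-- The renormalized solution `W_t(x) = exp(ε⁻¹·α₁·∫₀^t q(s)^{2/3} ds)·w(t,x)`. -/
noncomputable def Wfun (α₁ ε : ℝ) (q : ℝ → ℝ) (w : ℝ → ℝ → ℝ) (t x : ℝ) : ℝ :=
  Real.exp (ε⁻¹ * α₁ * ∫ s in (0:ℝ)..t, q s ^ ((2:ℝ)/3)) * w t x

noncomputable def aE (x : ℝ) (z : ℂ) : ℂ := Complex.exp (Complex.I * (z ^ 3 / 3 + x * z))

lemma aE_norm (x s y : ℝ) : ‖aE x (s + y * Complex.I)‖ = Real.exp (-(s^2*y) + y^3/3 - x*y) := by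
  unfold aE
  rw [Complex.norm_exp]
  congr 1
  have : Complex.I * (((s:ℂ) + y * Complex.I) ^ 3 / 3 + x * (s + y * Complex.I))
     = ((-(s^2*y) + y^3/3 - x*y : ℝ) : ℂ) + ((s^3/3 - s*y^2 + x*s : ℝ):ℂ) * Complex.I := by
    push_cast
    ring_nf
    simp only [Complex.I_sq, show Complex.I^3 = -Complex.I by rw [pow_succ, Complex.I_sq]; ring, show Complex.I^4 = 1 from Complex.I_pow_four]
    ring
  rw [this]
  simp only [Complex.add_re, Complex.ofReal_re, Complex.re_ofReal_mul, Complex.I_re, mul_zero, add_zero]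

lemma aE_hasDeriv (x : ℝ) (z : ℂ) : HasDerivAt (aE x) (aE x z * (Complex.I * (z^2 + x))) z := by
  unfold aE
  have h : HasDerivAt (fun z : ℂ => Complex.I * (z ^ 3 / 3 + x * z)) (Complex.I * (z^2 + x)) z := by
    have := (((hasDerivAt_pow 3 z).div_const 3).add ((hasDerivAt_id z).const_mul (x:ℂ))).const_mul Complex.I
    refine this.congr_deriv ?_
    simp
  exact h.cexp

lemma aE_cont (x : ℝ) : Continuous (aE x) :=
  continuous_iff_continuousAt.2 fun z => (aE_hasDeriv x z).continuousAt

noncomputable def zl (s : ℝ) : ℂ := (s:ℂ) + ((1:ℝ):ℂ) * Complex.I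

lemma zl_cont : Continuous zl := by unfold zl; fun_prop

lemma zl_norm (s : ℝ) : ‖zl s‖ ≤ s^2+1 := by
  have h : ‖zl s‖^2 = s^2+1 := by
    rw [← Complex.normSq_eq_norm_sq]; simp [zl, Complex.normSq_apply]; ring
  nlinarith [norm_nonneg (zl s), sq_nonneg s]

lemma zl_norm_sq (s : ℝ) : ‖zl s‖^2 = s^2+1 := by
    rw [← Complex.normSq_eq_norm_sq]; simp [zl, Complex.normSq_apply]; ring

lemma zl_pow (s : ℝ) (n : ℕ) (hn : n ≤ 2) : ‖(zl s)^n‖ ≤ 4 * Real.exp (s^2/4) := by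
  have h4 := Real.add_one_le_exp (s^2/4)
  have h5 : s^2+1 ≤ 4 * Real.exp (s^2/4) := by linarith
  rw [norm_pow]
  interval_cases n
  · simp; nlinarith [sq_nonneg s]
  · simpa using (zl_norm s).trans h5
  · rw [zl_norm_sq]; exact h5

noncomputable def aG (n : ℕ) (x : ℝ) : ℂ := ∫ s : ℝ, (zl s)^n * aE x (zl s)

lemma aG_bound (n : ℕ) (hn : n ≤ 2) (x s : ℝ) :
    ‖(zl s)^n * aE x (zl s)‖ ≤ (4 * Real.exp (1/3 - x)) * Real.exp (-(3/4) * s^2) := by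
  rw [norm_mul]
  have h := aE_norm x s 1
  rw [show aE x (zl s) = aE x (s + ((1:ℝ):ℂ) * Complex.I) from rfl, h]
  calc _ ≤ 4 * Real.exp (s^2/4) * Real.exp (-(s^2*1) + 1^3/3 - x*1) := by
        gcongr; exact zl_pow s n hn
    _ = _ := by
        rw [mul_assoc, mul_assoc, ← Real.exp_add, ← Real.exp_add]; ring_nf

lemma aG_cont (n : ℕ) (x : ℝ) : Continuous (fun s => (zl s)^n * aE x (zl s)) :=
  (zl_cont.pow n).mul ((aE_cont x).comp zl_cont)

lemma aG_int (n : ℕ) (hn : n ≤ 2) (x : ℝ) : Integrable (fun s => (zl s)^n * aE x (zl s)) := by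
  refine Integrable.mono' ((integrable_exp_neg_mul_sq (b := 3/4) (by norm_num)).const_mul (4 * Real.exp (1/3 - x))) (aG_cont n x).aestronglyMeasurable ?_
  exact Eventually.of_forall fun s => aG_bound n hn x s

lemma aG_deriv (n : ℕ) (hn : n + 1 ≤ 2) (x : ℝ) :
    HasDerivAt (aG n) (Complex.I * aG (n+1) x) x := by
  unfold aG
  rw [← integral_const_mul]
  refine (hasDerivAt_integral_of_dominated_loc_of_deriv_le (μ := volume)
    (bound := fun s => (4 * Real.exp (1/3 - (x-1))) * Real.exp (-(3/4) * s^2))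
    (F := fun x s => (zl s)^n * aE x (zl s)) 
    (F' := fun x s => Complex.I * ((zl s)^(n+1) * aE x (zl s)))
    (Metric.ball_mem_nhds x one_pos) ?_ (aG_int n (by omega) x) ?_ ?_ ?_ ?_).2
  · exact Eventually.of_forall fun y => (aG_cont n y).aestronglyMeasurable
  · exact (continuous_const.mul (aG_cont (n+1) x)).aestronglyMeasurable
  · refine Eventually.of_forall fun s y hy => ?_
    rw [norm_mul, Complex.norm_I, one_mul]
    refine (aG_bound (n+1) hn y s).trans ?_
    have := (abs_lt.1 (by simpa [Real.dist_eq] using hy : |y - x| < 1)).1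
    gcongr
    linarith
  · exact (integrable_exp_neg_mul_sq (b := 3/4) (by norm_num)).const_mul _
  · refine Eventually.of_forall fun s y hy => ?_
    unfold aE
    have h : HasDerivAt (fun y : ℝ => Complex.I * ((zl s) ^ 3 / 3 + (y:ℂ) * zl s)) (Complex.I * (zl s)) y := by
      have := (((Complex.ofRealCLM.hasDerivAt (x := y)).mul_const (zl s)).const_add ((zl s)^3/3)).const_mul Complex.I
      simpa using this
    have := h.cexp.const_mul ((zl s)^n)
    refine this.congr_deriv ?_
    ring

lemma sqbot : Tendsto (fun s : ℝ => s^2) atBot atTop := by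
  have h : Tendsto (fun s : ℝ => s^2) atTop atTop := tendsto_pow_atTop two_ne_zero
  refine (h.comp (tendsto_neg_atBot_atTop (G := ℝ))).congr fun s => ?_
  simp

lemma aG_ode (x : ℝ) : aG 2 x = - x * aG 0 x := by
  have key : ∫ s : ℝ, aE x (zl s) * (Complex.I * ((zl s)^2 + x)) = 0 - 0 := by
    have hi : Integrable (fun s : ℝ => aE x (zl s) * (Complex.I * ((zl s)^2 + x))) := by
      have := ((aG_int 2 le_rfl x).const_mul Complex.I).add ((aG_int 0 (by omega) x).const_mul (Complex.I * x))
      refine this.congr (Eventually.of_forall fun s => ?_)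
      simp; ring
    have hlim : ∀ l : Filter ℝ, Tendsto (fun s : ℝ => s^2) l atTop → Tendsto (fun s => aE x (zl s)) l (nhds 0) := by
      intro l hl
      rw [tendsto_zero_iff_norm_tendsto_zero]
      have h1 : Tendsto (fun s : ℝ => (4 * Real.exp (1/3 - x)) * Real.exp (-(3/4) * s^2)) l (nhds 0) := by
        rw [← mul_zero (4 * Real.exp (1/3 - x))]
        refine Tendsto.const_mul _ (Real.tendsto_exp_atBot.comp ?_)
        exact hl.const_mul_atTop_of_neg (by norm_num)
      refine squeeze_zero (fun _ => norm_nonneg _) (fun s => ?_) h1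
      simpa using aG_bound 0 (by omega) x s
    refine integral_of_hasDerivAt_of_tendsto (f := fun s => aE x (zl s)) (fun s => ?_) hi (hlim _ ?_) (hlim _ ?_)
    · have hz : HasDerivAt zl 1 s := by
        have := (Complex.ofRealCLM.hasDerivAt (x := s)).add_const (((1:ℝ):ℂ) * Complex.I)
        exact this.congr_deriv (by simp)
      exact ((aE_hasDeriv x (zl s)).comp s hz).congr_deriv (mul_one _)
    · exact (sqbot)
    · exact tendsto_pow_atTop two_ne_zero
  have h2 : ∫ s : ℝ, aE x (zl s) * (Complex.I * ((zl s)^2 + x)) = Complex.I * aG 2 x + Complex.I * x * aG 0 x := by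
    unfold aG
    rw [← integral_const_mul, ← integral_const_mul, ← integral_add ((aG_int 2 le_rfl x).const_mul _) ((aG_int 0 (by omega) x).const_mul _)]
    congr 1; ext s; simp; ring
  rw [h2] at key
  have : Complex.I * (aG 2 x + x * aG 0 x) = 0 := by linear_combination key
  have := (mul_eq_zero.1 this).resolve_left Complex.I_ne_zero
  linear_combination this

lemma aE_side (x : ℝ) (l : Filter ℝ) [l.IsCountablyGenerated] (hl : Tendsto (fun s : ℝ => s^2) l atTop) :
    Tendsto (fun R : ℝ => ∫ y in (0:ℝ)..1, aE x (R + y * Complex.I)) l (nhds 0) := by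
  have := intervalIntegral.tendsto_integral_filter_of_dominated_convergence (μ := volume) (a := 0) (b := 1) (l := l)
    (F := fun R y => aE x ((R:ℝ) + (y:ℝ) * Complex.I)) (f := fun _ => 0) (fun _ => Real.exp (1 + |x|)) ?_ ?_ ?_ ?_
  · simpa using this
  · refine Eventually.of_forall fun R => Continuous.aestronglyMeasurable ?_
    exact (aE_cont x).comp (by fun_prop)
  · refine Eventually.of_forall fun R => Eventually.of_forall fun y hy => ?_
    rw [uIoc_of_le zero_le_one] at hy
    rw [aE_norm]
    apply Real.exp_le_exp.2
    have h1 : y^3 ≤ 1 := pow_le_one₀ hy.1.le hy.2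
    have h2 : 0 ≤ R^2*y := mul_nonneg (sq_nonneg _) hy.1.le
    have h3 : -(x*y) ≤ |x| := by
      calc -(x*y) ≤ |x*y| := neg_le_abs _
        _ = |x| * y := by rw [abs_mul, abs_of_pos hy.1]
        _ ≤ |x| := mul_le_of_le_one_right (abs_nonneg _) hy.2
    linarith
  · simp
  · refine Eventually.of_forall fun y hy => ?_
    rw [uIoc_of_le zero_le_one] at hy
    rw [tendsto_zero_iff_norm_tendsto_zero]
    simp_rw [aE_norm]
    refine Real.tendsto_exp_atBot.comp ?_
    have : Tendsto (fun R : ℝ => -(R^2*y)) l atBot := tendsto_neg_atTop_atBot.comp (hl.atTop_mul_const hy.1)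
    have := tendsto_atBot_add_const_right l (y^3/3 - x*y) this
    refine this.congr fun R => by ring

lemma Ai_tendsto (x : ℝ) : Tendsto (fun R : ℝ => ∫ t in (0:ℝ)..R, Real.cos (t ^ 3 / 3 + x * t)) atTop (nhds ((aG 0 x).re / 2)) := by
  have hsq : Tendsto (fun s : ℝ => s^2) atTop atTop := tendsto_pow_atTop two_ne_zero
  have hrect : ∀ R : ℝ, ∫ s in (-R)..R, aE x s = (∫ s in (-R)..R, aE x (zl s)) - Complex.I * (∫ y in (0:ℝ)..1, aE x (R + y * Complex.I)) + Complex.I * ∫ y in (0:ℝ)..1, aE x ((-R:ℝ) + y * Complex.I) := by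
    intro R
    have := Complex.integral_boundary_rect_eq_zero_of_differentiableOn (aE x) ((-R:ℝ):ℂ) ((R:ℂ) + Complex.I)
      (fun z _ => (aE_hasDeriv x z).differentiableAt.differentiableWithinAt)
    simp at this
    simp only [zl]
    push_cast
    simp only [one_mul]
    linear_combination this
  have hlim : Tendsto (fun R : ℝ => ∫ s in (-R)..R, aE x s) atTop (nhds (aG 0 x)) := by
    have h1 : Tendsto (fun R : ℝ => ∫ s in (-R)..R, aE x (zl s)) atTop (nhds (aG 0 x)) := by
      have := intervalIntegral_tendsto_integral (aG_int 0 (by omega) x) tendsto_neg_atTop_atBot tendsto_id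
      simpa [aG] using this
    have h2 := (aE_side x atTop hsq).const_mul Complex.I
    have h3 := ((aE_side x atBot sqbot).comp tendsto_neg_atTop_atBot).const_mul Complex.I
    have := (h1.sub h2).add h3
    simp only [mul_zero, sub_zero, add_zero] at this
    exact this.congr fun R => (hrect R).symm
  have hre : ∀ R : ℝ, (∫ t in (0:ℝ)..R, Real.cos (t ^ 3 / 3 + x * t)) = (∫ s in (-R)..R, aE x s).re / 2 := by
    intro R
    have hc : Continuous (fun s : ℝ => aE x s) := (aE_cont x).comp Complex.continuous_ofReal
    have h1 : (∫ s in (-R)..R, aE x s).re = ∫ s in (-R)..R, Real.cos (s ^ 3 / 3 + x * s) := by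
      have := (Complex.reCLM.intervalIntegral_comp_comm (hc.intervalIntegrable (-R) R) (μ := volume))
      simp only [Complex.reCLM_apply] at this
      rw [← this]
      congr 1; ext s
      unfold aE
      rw [show Complex.I * ((s:ℂ) ^ 3 / 3 + x * s) = ((s^3/3 + x*s : ℝ) : ℂ) * Complex.I by push_cast; ring]
      exact Complex.exp_ofReal_mul_I_re _
    have hcc : Continuous (fun s : ℝ => Real.cos (s ^ 3 / 3 + x * s)) := by fun_prop
    rw [h1, ← intervalIntegral.integral_add_adjacent_intervals (hcc.intervalIntegrable (-R) 0) (hcc.intervalIntegrable 0 R)]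
    have : ∫ s in (-R)..0, Real.cos (s ^ 3 / 3 + x * s) = ∫ s in (0:ℝ)..R, Real.cos (s ^ 3 / 3 + x * s) := by
      have := intervalIntegral.integral_comp_neg (a := 0) (b := R) (fun s : ℝ => Real.cos (s ^ 3 / 3 + x * s))
      rw [neg_zero] at this
      rw [← this]
      congr 1; ext s
      rw [← Real.cos_neg]; congr 1; ring
    rw [this]; ring
  simp_rw [hre]
  exact ((Complex.continuous_re.tendsto _).comp hlim).div_const 2

lemma Ai_eq (x : ℝ) : Ai x = (1 / Real.pi) * ((aG 0 x).re / 2) := by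
  unfold Ai
  rw [(Ai_tendsto x).limUnder_eq]

lemma Ai_ode : ∃ B : ℝ → ℝ, (∀ x, HasDerivAt Ai (B x) x) ∧ ∀ x, HasDerivAt B (x * Ai x) x := by
  have hre : ∀ (f : ℝ → ℂ) (f' : ℂ) (x : ℝ), HasDerivAt f f' x → HasDerivAt (fun y => (f y).re) f'.re x := by
    intro f f' x h
    exact Complex.reCLM.hasFDerivAt.comp_hasDerivAt x h
  refine ⟨fun x => (1 / Real.pi) * ((Complex.I * aG 1 x).re / 2), fun x => ?_, fun x => ?_⟩
  · rw [show Ai = fun x => (1 / Real.pi) * ((aG 0 x).re / 2) from funext Ai_eq]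
    exact ((hre _ _ x (aG_deriv 0 (by omega) x)).div_const 2).const_mul _
  · have := ((hre _ _ x ((aG_deriv 1 (by omega) x).const_mul Complex.I)).div_const 2).const_mul (1/Real.pi)
    refine this.congr_deriv ?_
    rw [show (1+1) = 2 from rfl, aG_ode, Ai_eq, ← mul_assoc, Complex.I_mul_I]
    simp
    ring

lemma airy_pos (α₁ : ℝ) (hzero : Ai (-α₁) = 0)
    (hlargest : ∀ x : ℝ, -α₁ < x → Ai x ≠ 0) : ∃ A B : ℝ → ℝ, (∀ x, HasDerivAt A (B x) x) ∧ (∀ x, HasDerivAt B (x * A x) x) ∧ A (-α₁) = 0 ∧ ∀ x, -α₁ < x → 0 < A x := by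
  obtain ⟨B, h1, h2⟩ := Ai_ode
  have hc : Continuous Ai := continuous_iff_continuousAt.2 fun z => (h1 z).continuousAt
  have hs : (∀ x, -α₁ < x → 0 < Ai x) ∨ (∀ x, -α₁ < x → Ai x < 0) := by
    by_contra! hcon
    obtain ⟨⟨a, ha, ha'⟩, b, hb, hb'⟩ := hcon
    obtain ⟨c, hc1, hc2⟩ := (isPreconnected_Ioi (a := -α₁)).intermediate_value (mem_Ioi.2 ha) (mem_Ioi.2 hb) hc.continuousOn ⟨ha', hb'⟩
    exact hlargest c hc1 hc2
  rcases hs with hs | hs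
  · exact ⟨Ai, B, h1, h2, hzero, hs⟩
  · refine ⟨fun x => -Ai x, fun x => -B x, fun x => (h1 x).neg, fun x => ?_, by simp [hzero], fun x hx => by simpa using hs x hx⟩
    have := (h2 x).neg
    rwa [← mul_neg] at this

lemma wronsk (A B V : ℝ → ℝ) (h1 : ∀ x, HasDerivAt A (B x) x) (h2 : ∀ x, HasDerivAt B (V x * A x) x)
    (h c : ℝ) (hh : 0 < h) (hc : 0 ≤ c) (hA : ∀ x ∈ Icc 0 h, 0 ≤ A x) (hV : ∀ x ∈ Icc 0 h, V x ≤ c^2) :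
    B h * h ≤ A h * (1 + c*h) := by
  let W : ℝ → ℝ := fun y => A y * ((1 + c*y) * Real.exp (c*y)) - B y * (y * Real.exp (c*y))
  have hW : ∀ y, HasDerivAt W (A y * Real.exp (c*y) * (2*c + (c^2 - V y) * y)) y := by
    intro y
    have hl : HasDerivAt (fun y => c*y) c y := by simpa using! (hasDerivAt_id y).const_mul c
    have he := hl.exp
    have := ((h1 y).mul ((hl.const_add 1).mul he)).sub ((h2 y).mul ((hasDerivAt_id y).mul he))
    refine this.congr_deriv ?_
    simp
    ring
  have hmono : MonotoneOn W (Icc 0 h) := by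
    refine monotoneOn_of_deriv_nonneg (convex_Icc 0 h) (fun y _ => (hW y).continuousAt.continuousWithinAt)
      (fun y _ => (hW y).differentiableAt.differentiableWithinAt) fun y hy => ?_
    rw [interior_Icc] at hy
    have hy' := Ioo_subset_Icc_self hy
    rw [(hW y).deriv]
    have := hA y hy'
    have h3 := mul_nonneg (sub_nonneg.2 (hV y hy')) hy.1.le
    positivity
  have h0 := hmono (left_mem_Icc.2 hh.le) (right_mem_Icc.2 hh.le) hh.le
  have hA0 := hA 0 (left_mem_Icc.2 hh.le)
  simp only [W, mul_zero, add_zero, Real.exp_zero, mul_one, sub_zero] at h0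
  have h4 : 0 ≤ (A h * (1 + c*h) - B h * h) * Real.exp (c*h) := by nlinarith
  have := nonneg_of_mul_nonneg_left h4 (Real.exp_pos _)
  linarith

lemma exp_lin (δ : ℝ) (hδ : 0 < δ) (a b x : ℝ) (ha : 0 ≤ a) (hb : 0 ≤ b) (hx : 0 ≤ x) :
    (a + b * x) * (Real.exp (-δ*x))^2 ≤ (a + b/δ) * Real.exp (-δ*x) := by
  have h1 : Real.exp (-δ*x) ≤ 1 := Real.exp_le_one_iff.2 (by nlinarith)
  have hp := Real.exp_pos (-δ*x)
  have h2 : x * Real.exp (-δ*x) ≤ 1/δ := by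
    have h3 := Real.add_one_le_exp (δ*x)
    have h4 : Real.exp (δ*x) * Real.exp (-δ*x) = 1 := by rw [← Real.exp_add]; simp
    rw [le_div_iff₀ hδ]
    nlinarith
  have h3 : (a + b * x) * Real.exp (-δ*x) ≤ a + b/δ := by
    have : b * (x * Real.exp (-δ*x)) ≤ b * (1/δ) := by gcongr
    have e : b * (1/δ) = b/δ := by ring
    nlinarith
  nlinarith

lemma gbound (δ C : ℝ) (hδ : 0 < δ) (P m x u u2 v : ℝ) (hP : 0 ≤ P) (hm : 0 ≤ m) (hx : 0 ≤ x)
    (hu : |u| ≤ C * Real.exp (-δ*x)) (hu2 : |u2| ≤ C * Real.exp (-δ*x)) (hv : |v| ≤ P * x + m) :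
    |u * (u2 - v * u)| ≤ C^2 * (1 + m + P/δ) * Real.exp (-δ*x) := by
  have hC : 0 ≤ C * Real.exp (-δ*x) := (abs_nonneg _).trans hu
  rw [abs_mul]
  have h1 : |u2 - v*u| ≤ C * Real.exp (-δ*x) + (P*x+m) * (C * Real.exp (-δ*x)) := by
    refine (abs_sub _ _).trans ?_
    rw [abs_mul]
    gcongr
  calc |u| * |u2 - v*u| ≤ (C * Real.exp (-δ*x)) * (C * Real.exp (-δ*x) + (P*x+m) * (C * Real.exp (-δ*x))) := by
        gcongr
    _ = C^2 * (((1+m) + P*x) * (Real.exp (-δ*x))^2) := by ring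
    _ ≤ C^2 * ((1 + m + P/δ) * Real.exp (-δ*x)) := by
        exact mul_le_mul_of_nonneg_left (exp_lin δ hδ _ _ _ (by positivity) hP hx) (sq_nonneg C)
    _ = _ := by ring

lemma energy (A B : ℝ → ℝ) (p m : ℝ) (hp : 0 ≤ p) (h1 : ∀ x, HasDerivAt A (B x) x)
    (h2 : ∀ x, HasDerivAt B ((p*x - m) * A x) x) (hA0 : 0 ≤ A 0) (hA : ∀ x, 0 < x → 0 < A x)
    (δ C : ℝ) (hδ : 0 < δ) (u u1 u2 : ℝ → ℝ)
    (hc : ContinuousOn u (Ici 0)) (hu0 : u 0 = 0)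
    (hu1 : ∀ x, 0 < x → HasDerivAt u (u1 x) x) (hu2 : ∀ x, 0 < x → HasDerivAt u1 (u2 x) x)
    (b0 : ∀ x, 0 < x → |u x| ≤ C * Real.exp (-δ*x))
    (b1 : ∀ x, 0 < x → |u1 x| ≤ C * Real.exp (-δ*x))
    (hint : IntegrableOn (fun x => u x * (u2 x - (p*x - m) * u x)) (Ioi 0)) :
    ∫ x in Ioi (0:ℝ), u x * (u2 x - (p*x - m) * u x) ≤ 0 := by
  have hCe : ∀ x, 0 < x → 0 ≤ C * Real.exp (-δ*x) := fun x hx => (abs_nonneg _).trans (b0 x hx)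
  have hC : 0 ≤ C := nonneg_of_mul_nonneg_left (hCe 1 one_pos) (Real.exp_pos _)
  have b1' : ∀ x, 0 < x → |u1 x| ≤ C := fun x hx => (b1 x hx).trans
    (mul_le_of_le_one_right hC (Real.exp_le_one_iff.2 (by nlinarith)))
  have hlin : ∀ a, 0 < a → |u a| ≤ C * a := by
    intro a ha
    obtain ⟨c, hc1, hc2⟩ := exists_hasDerivAt_eq_slope u u1 ha (hc.mono Icc_subset_Ici_self) (fun x hx => hu1 x hx.1)
    rw [hu0, sub_zero, sub_zero, eq_div_iff ha.ne'] at hc2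
    rw [← hc2, abs_mul, abs_of_pos ha]
    gcongr
    exact b1' c hc1.1
  have hleft : ∀ a, 0 < a → a ≤ 1 → B a / A a ≤ 1/a + (1+p+|m|) := by
    intro a ha ha1
    have := wronsk A B (fun x => p*x-m) h1 h2 a (1+p+|m|) ha (by positivity) ?_ ?_
    · rw [div_le_iff₀ (hA a ha)]
      have e : (1/a + (1+p+|m|)) * A a = (A a * (1 + (1+p+|m|)*a)) / a := by field_simp
      rw [e, le_div_iff₀ ha]
      exact this
    · intro x hx
      rcases hx.1.eq_or_lt with h | h
      · rw [← h]; exact hA0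
      · exact (hA x h).le
    · intro x hx
      have h3 := neg_abs_le m
      have h4 := abs_nonneg m
      have h5 : p*x ≤ p := mul_le_of_le_one_right hp (hx.2.trans ha1)
      nlinarith
  have hright : ∀ b, 0 < b → -(B b / A b) ≤ 2 + p*(b+1) + |m| := by
    intro b hb
    have := wronsk (fun y => A (b+1-y)) (fun y => -B (b+1-y)) (fun y => p*(b+1-y)-m) ?_ ?_ 1 (1+p*(b+1)+|m|) one_pos (by positivity) ?_ ?_
    · simp only [add_sub_cancel_right, mul_one] at this
      rw [← neg_div, div_le_iff₀ (hA b hb)]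
      linarith
    · intro x
      have := (h1 (b+1-x)).comp x ((hasDerivAt_id x).const_sub (b+1))
      exact this.congr_deriv (by simp)
    · intro x
      have := ((h2 (b+1-x)).comp x ((hasDerivAt_id x).const_sub (b+1))).neg
      exact this.congr_deriv (by simp)
    · intro x hx
      exact (hA _ (by linarith [hx.2])).le
    · intro x hx
      have h3 := neg_abs_le m
      have h4 := abs_nonneg m
      have h5 : p*(b+1-x) ≤ p*(b+1) := by gcongr; linarith [hx.1]
      have h6 : 0 ≤ p*(b+1) := by positivity
      nlinarith
  let Φ : ℝ → ℝ := fun x => u x * u1 x - B x / A x * (u x)^2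
  have hΦ : ∀ x, 0 < x → HasDerivAt Φ (u x * (u2 x - (p*x - m) * u x) + (u1 x - B x / A x * u x)^2) x := by
    intro x hx
    have := ((hu1 x hx).mul (hu2 x hx)).sub (((h2 x).div (h1 x) (hA x hx).ne').mul ((hu1 x hx).pow 2))
    refine this.congr_deriv ?_
    have := (hA x hx).ne'
    simp
    field_simp
    ring
  have hab : ∀ a b, 0 < a → a ≤ b → ∫ x in a..b, u x * (u2 x - (p*x - m) * u x) ≤ Φ b - Φ a := by
    intro a b ha hb
    refine intervalIntegral.integral_le_sub_of_hasDeriv_right_of_le hb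
      (fun x hx => (hΦ x (ha.trans_le hx.1)).continuousAt.continuousWithinAt)
      (fun x hx => (hΦ x (ha.trans hx.1)).hasDerivWithinAt)
      (hint.mono_set fun x hx => ha.trans_le hx.1) fun x hx => ?_
    have := sq_nonneg (u1 x - B x / A x * u x)
    linarith
  have hΦb : ∀ b, 0 < b → Φ b ≤ C^2 * ((3 + p + |m|) + p/δ) * Real.exp (-δ*b) := by
    intro b hb
    have e1 : u b * u1 b ≤ (C * Real.exp (-δ*b)) * (C * Real.exp (-δ*b)) := by
      refine (le_abs_self _).trans ?_
      rw [abs_mul]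
      exact mul_le_mul (b0 b hb) (b1 b hb) (abs_nonneg _) (hCe b hb)
    have e2 : (u b)^2 ≤ (C * Real.exp (-δ*b))^2 := by
      rw [← sq_abs]; gcongr; exact b0 b hb
    have e3 : -(B b / A b) * (u b)^2 ≤ (2 + p*(b+1) + |m|) * (C * Real.exp (-δ*b))^2 :=
      mul_le_mul (hright b hb) e2 (sq_nonneg _) (by positivity)
    have e4 := mul_le_mul_of_nonneg_left (exp_lin δ hδ (3+p+|m|) p b (by positivity) hp hb.le) (sq_nonneg C)
    simp only [Φ]
    linarith
  have hΦa : ∀ a, 0 < a → a ≤ 1 → -Φ a ≤ C^2 * (2*a + (1+p+|m|)*a^2) := by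
    intro a ha ha1
    have e1 : -(u a * u1 a) ≤ (C * a) * C := by
      refine (neg_le_abs _).trans ?_
      rw [abs_mul]
      exact mul_le_mul (hlin a ha) (b1' a ha) (abs_nonneg _) (by positivity)
    have e2 : (u a)^2 ≤ (C * a)^2 := by
      rw [← sq_abs]; gcongr; exact hlin a ha
    have e3 : (B a / A a) * (u a)^2 ≤ (1/a + (1+p+|m|)) * (C * a)^2 :=
      mul_le_mul (hleft a ha ha1) e2 (sq_nonneg _) (by positivity)
    have e4 : (1/a + (1+p+|m|)) * (C * a)^2 = C^2 * (a + (1+p+|m|)*a^2) := by field_simp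
    simp only [Φ]
    linarith
  have hIoi : ∀ a, 0 < a → a ≤ 1 → ∫ x in Ioi a, u x * (u2 x - (p*x - m) * u x) ≤ C^2 * (2*a + (1+p+|m|)*a^2) := by
    intro a ha ha1
    have ht := intervalIntegral_tendsto_integral_Ioi a (hint.mono_set (Ioi_subset_Ioi ha.le)) tendsto_id
    have he : Tendsto (fun b : ℝ => C^2 * ((3 + p + |m|) + p/δ) * Real.exp (-δ*b) + C^2 * (2*a + (1+p+|m|)*a^2)) atTop
        (nhds (C^2 * ((3 + p + |m|) + p/δ) * 0 + C^2 * (2*a + (1+p+|m|)*a^2))) := by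
      refine (Tendsto.const_mul _ (Real.tendsto_exp_atBot.comp ?_)).add_const _
      exact tendsto_id.const_mul_atTop_of_neg (by linarith)
    rw [mul_zero, zero_add] at he
    refine le_of_tendsto_of_tendsto ht he ?_
    filter_upwards [eventually_ge_atTop a] with b hb
    have := hab a b ha hb
    have := hΦb b (ha.trans_le hb)
    have := hΦa a ha ha1
    simp only [id]
    linarith
  have hseq : Tendsto (fun n : ℕ => 1/((n:ℝ)+1)) atTop (nhds 0) := tendsto_one_div_add_atTop_nhds_zero_nat
  have ht := (aecover_Ioi_of_Ioi (μ := volume) hseq).integral_tendsto_of_countably_generated hint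
  have hr : Tendsto (fun n : ℕ => C^2 * (2*(1/((n:ℝ)+1)) + (1+p+|m|)*(1/((n:ℝ)+1))^2)) atTop (nhds (C^2 * (2*0 + (1+p+|m|)*0^2))) :=
    ((hseq.const_mul 2).add ((hseq.pow 2).const_mul _)).const_mul _
  simp only [mul_zero, ne_eq, OfNat.ofNat_ne_zero, not_false_eq_true, zero_pow, add_zero] at hr
  refine le_of_tendsto_of_tendsto' ht hr fun n => ?_
  have hn : 0 < 1/((n:ℝ)+1) := by positivity
  rw [Measure.restrict_restrict measurableSet_Ioi, inter_eq_left.2 (Ioi_subset_Ioi hn.le)]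
  exact hIoi _ hn (by rw [div_le_one (by positivity)]; linarith [(Nat.cast_nonneg n : (0:ℝ) ≤ n)])

lemma energy_airy (A B : ℝ → ℝ) (α k : ℝ) (hk : 0 < k) (h1 : ∀ x, HasDerivAt A (B x) x)
    (h2 : ∀ x, HasDerivAt B (x * A x) x) (hA0 : A (-α) = 0) (hA : ∀ x, -α < x → 0 < A x)
    (δ C : ℝ) (hδ : 0 < δ) (u u1 u2 : ℝ → ℝ)
    (hc : ContinuousOn u (Ici 0)) (hu0 : u 0 = 0)
    (hu1 : ∀ x, 0 < x → HasDerivAt u (u1 x) x) (hu2 : ∀ x, 0 < x → HasDerivAt u1 (u2 x) x)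
    (b0 : ∀ x, 0 < x → |u x| ≤ C * Real.exp (-δ*x))
    (b1 : ∀ x, 0 < x → |u1 x| ≤ C * Real.exp (-δ*x))
    (hint : IntegrableOn (fun x => u x * (u2 x - k^3 * x * u x)) (Ioi 0))
    (hint2 : IntegrableOn (fun x => (u x)^2) (Ioi 0)) :
    (∫ x in Ioi (0:ℝ), u x * (u2 x - k^3 * x * u x)) + k^2*α * ∫ x in Ioi (0:ℝ), (u x)^2 ≤ 0 := by
  have hl : ∀ x, HasDerivAt (fun x => k*x - α) k x := fun x => by
    simpa using! ((hasDerivAt_id x).const_mul k).sub_const α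
  have hi2 := hint.add (hint2.const_mul (k^2*α))
  rw [← integral_const_mul, ← integral_add hint (hint2.const_mul _)]
  have e : ∀ x, u x * (u2 x - k^3 * x * u x) + k^2*α * (u x)^2 = u x * (u2 x - (k^3*x - k^2*α) * u x) := fun x => by ring
  simp_rw [e]
  refine energy (fun x => A (k*x - α)) (fun x => k * B (k*x-α)) (k^3) (k^2*α) (by positivity) (fun x => ?_) (fun x => ?_) ?_ ?_ δ C hδ u u1 u2 hc hu0 hu1 hu2 b0 b1 ?_
  · exact ((h1 _).comp x (hl x)).congr_deriv (mul_comm _ _)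
  · exact (((h2 _).comp x (hl x)).const_mul k).congr_deriv (by ring)
  · simp [hA0]
  · intro x hx
    exact hA _ (by nlinarith [mul_pos hk hx])
  · exact hi2.congr (Eventually.of_forall fun x => e x)

/-- If `w` solves `∂ₜw = ε⁻¹(∂ₓ²w − q(t)·x·w)` on `[0,1]×[0,∞)` with Dirichlet boundary
condition at `0`, and `‖w(0,·)‖_{L²(0,∞)} ≤ 1`, then the renormalized solution
`W_t(x) = exp(ε⁻¹·α₁·∫₀^t q(s)^{2/3} ds)·w(t,x)` satisfies `‖W_t‖_{L²(0,∞)} ≤ 1` for all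
`t ∈ [0,1]`. Here `−α₁` is the largest zero of `Ai`. -/
theorem renormalized_solution_l2_contraction
    (α₁ : ℝ) (hα₁ : 0 < α₁) (hzero : Ai (-α₁) = 0)
    (hlargest : ∀ x : ℝ, -α₁ < x → Ai x ≠ 0)
    (ε : ℝ) (hε : 0 < ε)
    (q : ℝ → ℝ) (hq : ContDiffOn ℝ 1 q (Set.Icc 0 1))
    (hqpos : ∀ t ∈ Set.Icc (0:ℝ) 1, 0 < q t)
    (w : ℝ → ℝ → ℝ)
    (hsmooth : ContDiffOn ℝ (⊤ : ℕ∞) (fun p : ℝ × ℝ => w p.1 p.2) (Set.Icc 0 1 ×ˢ Set.Ici 0))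
    (hdecay : ∃ δ : ℝ, 0 < δ ∧ ∀ t ∈ Set.Icc (0:ℝ) 1, ∀ x ∈ Set.Ici (0:ℝ),
      |w t x| + |deriv (w t) x| + |deriv (deriv (w t)) x| ≤ δ⁻¹ * Real.exp (-δ * x))
    (hpde : ∀ t ∈ Set.Icc (0:ℝ) 1, ∀ x ∈ Set.Ici (0:ℝ),
      deriv (fun s => w s x) t = ε⁻¹ * (deriv (deriv (w t)) x - q t * x * w t x))
    (hbc : ∀ t ∈ Set.Icc (0:ℝ) 1, w t 0 = 0)
    (hinit : (∫ x in Set.Ioi (0:ℝ), (w 0 x) ^ 2) ≤ 1) :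
    ∀ t ∈ Set.Icc (0:ℝ) 1,
      (∫ x in Set.Ioi (0:ℝ), (Wfun α₁ ε q w t x) ^ 2) ≤ 1 := by
  obtain ⟨A, B, hA1, hA2, hA0, hApos⟩ := airy_pos α₁ hzero hlargest
  obtain ⟨δ, hδ, hdec⟩ := hdecay
  have hC : 0 ≤ δ⁻¹ := by positivity
  obtain ⟨Q, hQ⟩ := isCompact_Icc.exists_bound_of_continuousOn hq.continuousOn
  have hQ0 : 0 ≤ Q := (norm_nonneg _).trans (hQ 0 (by simp))
  have b0 : ∀ t ∈ Icc (0:ℝ) 1, ∀ x, 0 < x → |w t x| ≤ δ⁻¹ * Real.exp (-δ * x) := fun t ht x hx => by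
    have := hdec t ht x (mem_Ici.2 hx.le)
    linarith [abs_nonneg (deriv (w t) x), abs_nonneg (deriv (deriv (w t)) x)]
  have b1 : ∀ t ∈ Icc (0:ℝ) 1, ∀ x, 0 < x → |deriv (w t) x| ≤ δ⁻¹ * Real.exp (-δ * x) := fun t ht x hx => by
    have := hdec t ht x (mem_Ici.2 hx.le)
    linarith [abs_nonneg (w t x), abs_nonneg (deriv (deriv (w t)) x)]
  have b2 : ∀ t ∈ Icc (0:ℝ) 1, ∀ x, 0 < x → |deriv (deriv (w t)) x| ≤ δ⁻¹ * Real.exp (-δ * x) := fun t ht x hx => by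
    have := hdec t ht x (mem_Ici.2 hx.le)
    linarith [abs_nonneg (w t x), abs_nonneg (deriv (w t) x)]
  have hcx : ∀ t ∈ Icc (0:ℝ) 1, ContinuousOn (w t) (Ici 0) := fun t ht => by
    exact hsmooth.continuousOn.comp (f := fun x : ℝ => (t, x)) (by fun_prop) (fun x hx => ⟨ht, hx⟩)
  have hct : ∀ x, 0 < x → ContinuousOn (fun s => w s x) (Icc 0 1) := fun x hx => by
    exact hsmooth.continuousOn.comp (f := fun s : ℝ => (s, x)) (by fun_prop) (fun s hs => ⟨hs, hx.le⟩)
  have hat : ∀ t ∈ Ioo (0:ℝ) 1, ∀ x, 0 < x → ContDiffAt ℝ (⊤ : ℕ∞) (fun p : ℝ × ℝ => w p.1 p.2) (t, x) := fun t ht x hx =>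
    (hsmooth (t, x) ⟨Ioo_subset_Icc_self ht, hx.le⟩).contDiffAt
      (prod_mem_nhds (Icc_mem_nhds ht.1 ht.2) (Ici_mem_nhds hx))
  have hwx : ∀ t ∈ Ioo (0:ℝ) 1, ContDiffOn ℝ (⊤ : ℕ∞) (w t) (Ioi 0) := fun t ht x hx =>
    ((hat t ht x hx).comp (f := fun x : ℝ => (t, x)) x (by fun_prop)).contDiffWithinAt
  have hwt : ∀ t ∈ Ioo (0:ℝ) 1, ∀ x, 0 < x → HasDerivAt (fun s => w s x) (ε⁻¹ * (deriv (deriv (w t)) x - q t * x * w t x)) t := by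
    intro t ht x hx
    rw [← hpde t (Ioo_subset_Icc_self ht) x hx.le]
    have : ContDiffAt ℝ (⊤ : ℕ∞) (fun s => w s x) t := (hat t ht x hx).comp (f := fun s : ℝ => (s, x)) t (by fun_prop)
    exact (this.differentiableAt (by simp)).hasDerivAt
  have hwx1 : ∀ t ∈ Ioo (0:ℝ) 1, ∀ x, 0 < x → HasDerivAt (w t) (deriv (w t) x) x := fun t ht x hx =>
    (((hwx t ht).differentiableOn (by simp)).differentiableAt (Ioi_mem_nhds hx)).hasDerivAt
  have hwx2 : ∀ t ∈ Ioo (0:ℝ) 1, ∀ x, 0 < x → HasDerivAt (deriv (w t)) (deriv (deriv (w t)) x) x := fun t ht x hx => by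
    have : ContDiffOn ℝ 1 (deriv (w t)) (Ioi 0) := (hwx t ht).deriv_of_isOpen isOpen_Ioi (WithTop.coe_le_coe.2 (le_top : (1 + 1 : ℕ∞) ≤ ⊤))
    exact ((this.differentiableOn (by simp)).differentiableAt (Ioi_mem_nhds hx)).hasDerivAt
  have hexp : IntegrableOn (fun x : ℝ => Real.exp (-δ * x)) (Ioi 0) := exp_neg_integrableOn_Ioi 0 hδ
  have hae : ∀ {P : ℝ → Prop}, (∀ x, 0 < x → P x) → ∀ᵐ x ∂(volume.restrict (Ioi (0:ℝ))), P x := fun h =>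
    (ae_restrict_iff' measurableSet_Ioi).2 (Eventually.of_forall h)
  have hm : ∀ t ∈ Icc (0:ℝ) 1, AEStronglyMeasurable (w t) (volume.restrict (Ioi 0)) := fun t ht =>
    ((hcx t ht).mono Ioi_subset_Ici_self).aestronglyMeasurable measurableSet_Ioi
  have hsqb : ∀ t ∈ Icc (0:ℝ) 1, ∀ x, 0 < x → ‖(w t x)^2‖ ≤ δ⁻¹ * δ⁻¹ * Real.exp (-δ * x) := fun t ht x hx => by
    have h0 := b0 t ht x hx
    have h1 : Real.exp (-δ*x) ≤ 1 := Real.exp_le_one_iff.2 (by nlinarith)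
    rw [norm_pow, Real.norm_eq_abs, sq]
    calc |w t x| * |w t x| ≤ (δ⁻¹ * 1) * (δ⁻¹ * Real.exp (-δ * x)) := by
          refine mul_le_mul (h0.trans ?_) h0 (abs_nonneg _) (by positivity)
          gcongr
      _ = _ := by ring
  have hsqi : ∀ t ∈ Icc (0:ℝ) 1, IntegrableOn (fun x => (w t x)^2) (Ioi 0) := fun t ht =>
    Integrable.mono' (hexp.const_mul (δ⁻¹ * δ⁻¹)) ((hm t ht).pow 2) (hae (hsqb t ht))
  have hgb : ∀ t ∈ Icc (0:ℝ) 1, ∀ x, 0 < x → |w t x * (deriv (deriv (w t)) x - q t * x * w t x)| ≤ δ⁻¹^2 * (1 + 0 + Q/δ) * Real.exp (-δ * x) := by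
    intro t ht x hx
    refine gbound δ δ⁻¹ hδ Q 0 x _ _ _ hQ0 le_rfl hx.le (b0 t ht x hx) (b2 t ht x hx) ?_
    rw [abs_mul, abs_of_pos hx, add_zero]
    gcongr
    exact hQ t ht
  have hgm : ∀ t ∈ Icc (0:ℝ) 1, AEStronglyMeasurable (fun x => w t x * (deriv (deriv (w t)) x - q t * x * w t x)) (volume.restrict (Ioi 0)) := by
    intro t ht
    have hx : AEStronglyMeasurable (fun x : ℝ => q t * x) (volume.restrict (Ioi 0)) := (by fun_prop : Continuous fun x : ℝ => q t * x).aestronglyMeasurable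
    exact (hm t ht).mul ((stronglyMeasurable_deriv _).aestronglyMeasurable.sub (hx.mul (hm t ht)))
  have hgi : ∀ t ∈ Icc (0:ℝ) 1, IntegrableOn (fun x => w t x * (deriv (deriv (w t)) x - q t * x * w t x)) (Ioi 0) := fun t ht =>
    Integrable.mono' (hexp.const_mul _) (hgm t ht) (hae (hgb t ht))
  let E : ℝ → ℝ := fun t => ∫ x in Ioi (0:ℝ), (w t x)^2
  have hEc : ContinuousOn E (Icc 0 1) := by
    refine continuousOn_of_dominated (bound := fun x => δ⁻¹ * δ⁻¹ * Real.exp (-δ * x)) (fun t ht => (hm t ht).pow 2) (fun t ht => hae (hsqb t ht)) (hexp.const_mul _) (hae fun x hx => (hct x hx).pow 2)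
  have hEd : ∀ t ∈ Ioo (0:ℝ) 1, HasDerivAt E (2 * ε⁻¹ * ∫ x in Ioi (0:ℝ), w t x * (deriv (deriv (w t)) x - q t * x * w t x)) t := by
    intro t ht
    rw [← integral_const_mul]
    refine (hasDerivAt_integral_of_dominated_loc_of_deriv_le (μ := volume.restrict (Ioi 0))
      (bound := fun x => 2 * ε⁻¹ * (δ⁻¹^2 * (1 + 0 + Q/δ) * Real.exp (-δ * x)))
      (F := fun t x => (w t x)^2)
      (F' := fun t x => 2 * ε⁻¹ * (w t x * (deriv (deriv (w t)) x - q t * x * w t x)))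
      (Ioo_mem_nhds ht.1 ht.2) ?_ (hsqi t (Ioo_subset_Icc_self ht)) ?_ ?_ ?_ ?_).2
    · filter_upwards [Ioo_mem_nhds ht.1 ht.2] with s hs
      exact (hm s (Ioo_subset_Icc_self hs)).pow 2
    · exact (hgm t (Ioo_subset_Icc_self ht)).const_mul _
    · refine hae fun x hx s hs => ?_
      rw [norm_mul, Real.norm_of_nonneg (by positivity : 0 ≤ 2 * ε⁻¹)]
      exact mul_le_mul_of_nonneg_left (hgb s (Ioo_subset_Icc_self hs) x hx) (by positivity)
    · exact (hexp.const_mul _).const_mul _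
    · refine hae fun x hx s hs => ?_
      refine ((hwt s hs x hx).pow 2).congr_deriv ?_
      simp
      ring
  let r : ℝ → ℝ := fun s => q s ^ ((2:ℝ)/3)
  have hrc : ContinuousOn r (Icc 0 1) := hq.continuousOn.rpow_const fun t ht => Or.inl (hqpos t ht).ne'
  let θ : ℝ → ℝ := fun t => ∫ s in (0:ℝ)..t, r s
  have hθc : ContinuousOn θ (Icc 0 1) := by
    have := intervalIntegral.continuousOn_primitive_interval (μ := volume) (a := 0) (b := 1) (f := r)
      (by rw [uIcc_of_le zero_le_one]; exact hrc.integrableOn_Icc)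
    rwa [uIcc_of_le zero_le_one] at this
  have hθd : ∀ t ∈ Ioo (0:ℝ) 1, HasDerivAt θ (r t) t := by
    intro t ht
    refine intervalIntegral.integral_hasDerivAt_right ?_ ?_ ?_
    · refine ContinuousOn.intervalIntegrable ?_
      rw [uIcc_of_le ht.1.le]
      exact hrc.mono (Icc_subset_Icc_right ht.2.le)
    · exact (hrc.mono Ioo_subset_Icc_self).stronglyMeasurableAtFilter isOpen_Ioo t ht
    · exact hrc.continuousAt (Icc_mem_nhds ht.1 ht.2)
  let H : ℝ → ℝ := fun t => (Real.exp (ε⁻¹ * α₁ * θ t))^2 * E t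
  have hHc : ContinuousOn H (Icc 0 1) := by
    exact ((Real.continuous_exp.comp_continuousOn (continuousOn_const.mul hθc)).pow 2).mul hEc
  have hHd : ∀ t ∈ Ioo (0:ℝ) 1, HasDerivAt H (2 * ε⁻¹ * (Real.exp (ε⁻¹ * α₁ * θ t))^2 * ((∫ x in Ioi (0:ℝ), w t x * (deriv (deriv (w t)) x - q t * x * w t x)) + r t * α₁ * E t)) t := by
    intro t ht
    have := ((((hθd t ht).const_mul (ε⁻¹ * α₁)).exp).pow 2).mul (hEd t ht)
    refine this.congr_deriv ?_
    simp
    ring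
  have hanti : AntitoneOn H (Icc 0 1) := by
    refine antitoneOn_of_deriv_nonpos (convex_Icc 0 1) hHc ?_ ?_
    · rw [interior_Icc]
      exact fun t ht => (hHd t ht).differentiableAt.differentiableWithinAt
    · rw [interior_Icc]
      intro t ht
      have ht' := Ioo_subset_Icc_self ht
      rw [(hHd t ht).deriv]
      have hqt := hqpos t ht'
      let k : ℝ := q t ^ ((1:ℝ)/3)
      have hk : 0 < k := Real.rpow_pos_of_pos hqt _
      have hk3 : k^3 = q t := by
        simp only [k]
        rw [← Real.rpow_natCast, ← Real.rpow_mul hqt.le]; norm_num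
      have hk2 : k^2 = r t := by
        simp only [k, r]
        rw [← Real.rpow_natCast, ← Real.rpow_mul hqt.le]; norm_num
      have := energy_airy A B α₁ k hk hA1 hA2 hA0 hApos δ δ⁻¹ hδ (w t) (deriv (w t)) (deriv (deriv (w t)))
        (hcx t ht') (hbc t ht') (hwx1 t ht) (hwx2 t ht) (b0 t ht') (b1 t ht')
        (by rw [hk3]; exact hgi t ht') (hsqi t ht')
      rw [hk3, hk2] at this
      exact mul_nonpos_of_nonneg_of_nonpos (by positivity) this
  intro t ht
  have h := hanti (left_mem_Icc.2 zero_le_one) ht ht.1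
  have e0 : H 0 = E 0 := by simp [H, θ]
  have et : ∫ x in Set.Ioi (0:ℝ), (Wfun α₁ ε q w t x) ^ 2 = H t := by
    simp only [Wfun, mul_pow]
    rw [integral_const_mul]
  rw [et]
  exact h.trans (e0.le.trans hinit)
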